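/- arXiv:2101.09482 — 7 statements merged into one kernel-verified Lean document; each statement's English description precedes it below -/
import Mathlib

section
/- Let (Ω, F, P) be a probability space and let X, X̄ : [0,∞) × Ω → ℝ^d be jointly measurable stochastic processes. Let A : ℝ^d → ℝ be Lipschitz continuous, let m ∈ ℝ, and for a moderate scale function a set l_t^A := (1/a(t)) ∫₀ᵗ (A(X_s) − m) ds and l̄_t^A := (1/a(t)) ∫₀ᵗ (A(X̄_s) − m) ds. Let I : ℝ → [0,∞] be a good rate function. Assume: (i) for every moderate scale function a and every closed set F ⊆ ℝ, limsup_{t→∞} (t / a(t)²) · log P(l̄_t^A ∈ F) ≤ − inf_{y∈F} I(y); (ii) there exists δ > 0 such that E[ exp( δ ∫₀^∞ |X_s − X̄_s| ds ) ] < ∞. Then for every moderate scale function a and every closed set F ⊆ ℝ, limsup_{t→∞} (t / a(t)²) · log P(l_t^A ∈ F) ≤ − inf_{y∈F} I(y). -/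
open Filter MeasureTheory Topology

/-- A moderate scale function: positive on `(0,∞)`, with `√t / a t → 0` and `a t / t → 0`
as `t → ∞`. -/
def ModerateScale (a : ℝ → ℝ) : Prop :=
  (∀ t > 0, 0 < a t) ∧
    Tendsto (fun t => Real.sqrt t / a t) atTop (𝓝 0) ∧
    Tendsto (fun t => a t / t) atTop (𝓝 0)

/-- Exponential form of an upper bound on a rescaled logarithm. -/
lemma coe_mul_log_le_iff {s c : ℝ} (hs : 0 < s) (p : ENNReal) :
    (s : EReal) * ENNReal.log p ≤ c ↔ p ≤ ENNReal.ofReal (Real.exp (c / s)) := by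
  rw [← EReal.exp_coe, ← ENNReal.log_le_log_iff, EReal.log_exp, EReal.coe_div,
    EReal.le_div_iff_mul_le (by exact_mod_cast hs) (EReal.coe_ne_top s), mul_comm]

/-- The infimum of a good rate function over a closed set is approached along closed
thickenings of that set. -/
lemma exists_le_iInf_cthickening {I : ℝ → ENNReal}
    (hI : ∀ c : ENNReal, c ≠ ⊤ → IsCompact {y : ℝ | I y ≤ c}) {F : Set ℝ} (hF : IsClosed F)
    {c : ℝ} (hc : -(⨅ y ∈ F, (I y : EReal)) < c) :
    ∃ η > 0, -(⨅ y ∈ Metric.cthickening η F, (I y : EReal)) ≤ c := by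
  have hdisj : Disjoint {y : ℝ | I y ≤ ENNReal.ofReal (-c)} F ∨ 0 < c := by
    rcases lt_or_ge 0 c with h | h
    · exact Or.inr h
    · refine Or.inl (Set.disjoint_left.2 fun y hy hyF => ?_)
      refine absurd hc (not_lt.2 ?_)
      rw [EReal.le_neg, ← EReal.coe_neg]
      refine (iInf₂_le y hyF).trans ?_
      have := EReal.coe_ennreal_le_coe_ennreal_iff.2 hy
      rwa [EReal.coe_ennreal_ofReal, max_eq_left (by linarith)] at this
  rcases hdisj with h | h
  · obtain ⟨η, hη, hd⟩ := h.exists_cthickenings (hI _ ENNReal.ofReal_ne_top) hF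
    refine ⟨η, hη, ?_⟩
    rw [EReal.neg_le, ← EReal.coe_neg]
    refine le_iInf₂ fun y hy => ?_
    have hy' : ENNReal.ofReal (-c) < I y := by
      by_contra! hle
      exact Set.disjoint_left.1 hd (Metric.self_subset_cthickening _ hle) hy
    have := EReal.coe_ennreal_le_coe_ennreal_iff.2 hy'.le
    rw [EReal.coe_ennreal_ofReal] at this
    exact (EReal.coe_le_coe_iff.2 (le_max_left _ _)).trans this
  · refine ⟨1, one_pos, ?_⟩
    rw [EReal.neg_le, ← EReal.coe_neg]
    refine le_iInf₂ fun y _ => le_trans ?_ (EReal.coe_ennreal_nonneg _)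
    exact_mod_cast neg_nonpos.2 h.le

/-- Time integrals of a Lipschitz observable along two measurable paths differ by at most the
Lipschitz constant times the integrated distance of the paths. -/
lemma abs_integral_sub_le_of_lintegral_le {E : Type*} [NormedAddCommGroup E]
    [MeasurableSpace E] [BorelSpace E] {A : E → ℝ} {K : NNReal} (hA : LipschitzWith K A)
    (m : ℝ) {x y : ℝ → E} (hx : Measurable x) (hy : Measurable y) {t r : ℝ} (ht : 0 ≤ t)
    (hr : 0 ≤ r)
    (h : ∫⁻ s in Set.Ioi (0 : ℝ), ENNReal.ofReal ‖x s - y s‖ ≤ ENNReal.ofReal r) :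
    |(∫ s in (0 : ℝ)..t, (A (x s) - m)) - ∫ s in (0 : ℝ)..t, (A (y s) - m)| ≤ K * r := by
  have hle : ∀ s, ‖(A (x s) - m) - (A (y s) - m)‖ ≤ K * ‖x s - y s‖ := fun s => by
    rw [sub_sub_sub_cancel_right, ← dist_eq_norm, ← dist_eq_norm]
    exact hA.dist_le_mul _ _
  have hmx : Measurable fun s => A (x s) - m :=
    (hA.continuous.measurable.comp hx).sub_const m
  have hmy : Measurable fun s => A (y s) - m :=
    (hA.continuous.measurable.comp hy).sub_const m
  have hlint : ∫⁻ s in Set.Ioc 0 t, ‖(A (x s) - m) - (A (y s) - m)‖ₑ ≤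
      ENNReal.ofReal (K * r) := by
    calc ∫⁻ s in Set.Ioc 0 t, ‖(A (x s) - m) - (A (y s) - m)‖ₑ
        ≤ ∫⁻ s in Set.Ioi 0, ‖(A (x s) - m) - (A (y s) - m)‖ₑ :=
          lintegral_mono_set Set.Ioc_subset_Ioi_self
      _ ≤ ∫⁻ s in Set.Ioi 0, (K : ENNReal) * ENNReal.ofReal ‖x s - y s‖ := by
          refine lintegral_mono fun s => ?_
          rw [← ofReal_norm, ← ENNReal.ofReal_coe_nnreal, ← ENNReal.ofReal_mul K.coe_nonneg]
          exact ENNReal.ofReal_le_ofReal (hle s)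
      _ = K * ∫⁻ s in Set.Ioi 0, ENNReal.ofReal ‖x s - y s‖ :=
          lintegral_const_mul' _ _ ENNReal.coe_ne_top
      _ ≤ K * ENNReal.ofReal r := by gcongr
      _ = ENNReal.ofReal (K * r) := by
          rw [ENNReal.ofReal_mul K.coe_nonneg, ENNReal.ofReal_coe_nnreal]
  have hdiff : IntegrableOn (fun s => (A (x s) - m) - (A (y s) - m)) (Set.Ioc 0 t) :=
    ⟨(hmx.sub hmy).aestronglyMeasurable, hlint.trans_lt ENNReal.ofReal_lt_top⟩
  rw [intervalIntegral.integral_of_le ht, intervalIntegral.integral_of_le ht]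
  by_cases hyi : IntegrableOn (fun s => A (y s) - m) (Set.Ioc 0 t)
  · have hxi : IntegrableOn (fun s => A (x s) - m) (Set.Ioc 0 t) := by
      exact (hdiff.add hyi).congr_fun (fun s _ => sub_add_cancel _ _) measurableSet_Ioc
    rw [← integral_sub hxi hyi, ← Real.norm_eq_abs,
      ← ENNReal.ofReal_le_ofReal_iff (by positivity), ofReal_norm]
    exact (enorm_integral_le_lintegral_enorm _).trans hlint
  · have hxi : ¬ IntegrableOn (fun s => A (x s) - m) (Set.Ioc 0 t) := fun hxi =>
      hyi ((hxi.sub hdiff).congr_fun (fun s _ => sub_sub_cancel _ _) measurableSet_Ioc)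
    rw [integral_undef hxi, integral_undef hyi, sub_zero, abs_zero]
    positivity

/-- Exponential Chebyshev inequality for an extended nonnegative random variable. -/
lemma measure_gt_le_exp {Ω : Type*} [MeasurableSpace Ω] {P : Measure Ω} {Z : Ω → ENNReal}
    (hZ : Measurable Z) {δ : ℝ} (hδ : 0 < δ)
    (hexp : ∫⁻ ω, EReal.exp ((δ : EReal) * (Z ω : EReal)) ∂P < ⊤) :
    ∃ b : ℝ, ∀ r : ℝ, 0 ≤ r →
      P {ω | ENNReal.ofReal r < Z ω} ≤ ENNReal.ofReal (Real.exp (b - δ * r)) := by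
  set C := ∫⁻ ω, EReal.exp ((δ : EReal) * (Z ω : EReal)) ∂P with hC
  refine ⟨C.toReal, fun r hr => ?_⟩
  have hmeas : Measurable fun ω => EReal.exp ((δ : EReal) * (Z ω : EReal)) :=
    EReal.measurable_exp.comp (hZ.coe_ereal_ennreal.const_mul _)
  have hsub : {ω | ENNReal.ofReal r < Z ω} ⊆
      {ω | ENNReal.ofReal (Real.exp (δ * r)) ≤ EReal.exp ((δ : EReal) * (Z ω : EReal))} := by
    intro ω hω
    have h1 := EReal.coe_ennreal_le_coe_ennreal_iff.2 (le_of_lt hω)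
    rw [EReal.coe_ennreal_ofReal, max_eq_left hr] at h1
    rw [Set.mem_ofPred_eq, ← EReal.exp_coe, EReal.coe_mul]
    exact EReal.exp_monotone (mul_le_mul_of_nonneg_left h1 (by exact_mod_cast hδ.le))
  refine (measure_mono hsub).trans ((meas_ge_le_lintegral_div hmeas.aemeasurable
    (by simp [Real.exp_pos]) ENNReal.ofReal_ne_top).trans ?_)
  rw [← hC, Real.exp_sub, ENNReal.ofReal_div_of_pos (Real.exp_pos _)]
  gcongr
  refine (ENNReal.le_ofReal_iff_toReal_le hexp.ne (Real.exp_pos _).le).2 ?_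
  linarith [Real.add_one_le_exp C.toReal]

namespace ModerateScale

variable {a : ℝ → ℝ}

lemma tendsto_inv (ha : ModerateScale a) : Tendsto (fun t => (a t)⁻¹) atTop (𝓝 0) := by
  refine squeeze_zero' ?_ ?_ ha.2.1
  · filter_upwards [eventually_gt_atTop 0] with t ht using inv_nonneg.2 (ha.1 t ht).le
  · filter_upwards [eventually_ge_atTop 1] with t ht
    rw [inv_eq_one_div]
    have := ha.1 t (by linarith)
    gcongr
    exact Real.one_le_sqrt.2 ht

lemma tendsto_speed (ha : ModerateScale a) :
    Tendsto (fun t => t / a t ^ 2) atTop (𝓝 0) := by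
  have h := ha.2.1.pow 2
  rw [zero_pow two_ne_zero] at h
  refine h.congr' ?_
  filter_upwards [eventually_ge_atTop 0] with t ht
  rw [div_pow, Real.sq_sqrt ht]

/-- On a moderate scale, exponential decay at rate `a t` beats every multiple of
`a t ^ 2 / t`. -/
lemma eventually_sub_le (ha : ModerateScale a) (b c : ℝ) {κ : ℝ} (hκ : 0 < κ) :
    ∀ᶠ t in atTop, b - κ * a t ≤ c / (t / a t ^ 2) := by
  have h : Tendsto (fun t => b * (a t)⁻¹ - c * (a t / t)) atTop (𝓝 0) := by
    simpa using (ha.tendsto_inv.const_mul b).sub (ha.2.2.const_mul c)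
  filter_upwards [h.eventually_lt_const hκ, eventually_gt_atTop 0] with t ht htpos
  have hat := ha.1 t htpos
  have h1 := mul_lt_mul_of_pos_right ht hat
  have h2 : (b * (a t)⁻¹ - c * (a t / t)) * a t = b - c / (t / a t ^ 2) := by
    field_simp
  linarith

end ModerateScale

/-- If two families of probabilities are eventually below the exponential threshold `c`, then the
rescaled logarithm of any family bounded by their sum is eventually at most any `c' > c`. -/
lemma eventually_log_le_of_le_add {s : ℝ → ℝ} (hs : ∀ᶠ t in atTop, 0 < s t)
    (hs0 : Tendsto s atTop (𝓝 0)) {p q r : ℝ → ENNReal} {c c' : ℝ} (hcc' : c < c')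
    (hq : ∀ᶠ t in atTop, q t ≤ ENNReal.ofReal (Real.exp (c / s t)))
    (hr : ∀ᶠ t in atTop, r t ≤ ENNReal.ofReal (Real.exp (c / s t)))
    (hp : ∀ᶠ t in atTop, p t ≤ q t + r t) :
    ∀ᶠ t in atTop, (s t : EReal) * ENNReal.log (p t) ≤ c' := by
  have h2 : Tendsto (fun t => s t * Real.log 2) atTop (𝓝 0) := by
    simpa using hs0.mul_const (Real.log 2)
  filter_upwards [hs, hq, hr, hp, h2.eventually_lt_const (sub_pos.2 hcc')]
    with t hst hqt hrt hpt hlt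
  rw [coe_mul_log_le_iff hst]
  refine hpt.trans ((add_le_add hqt hrt).trans ?_)
  rw [← ENNReal.ofReal_add (Real.exp_pos _).le (Real.exp_pos _).le, ← two_mul]
  refine ENNReal.ofReal_le_ofReal ?_
  rw [← Real.exp_log (show (0 : ℝ) < 2 by norm_num), ← Real.exp_add]
  refine Real.exp_le_exp.2 ?_
  rw [le_div_iff₀ hst, add_mul, div_mul_cancel₀ _ hst.ne']
  linarith

theorem stmt_2
    {Ω : Type*} [MeasurableSpace Ω] (P : Measure Ω) [IsProbabilityMeasure P]
    (d : ℕ)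
    (X Xbar : ℝ → Ω → EuclideanSpace ℝ (Fin d))
    (hX : Measurable (Function.uncurry X)) (hXbar : Measurable (Function.uncurry Xbar))
    (A : EuclideanSpace ℝ (Fin d) → ℝ) (K : NNReal) (hA : LipschitzWith K A)
    (m : ℝ)
    (I : ℝ → ENNReal) (hI_lsc : LowerSemicontinuous I)
    (hI_good : ∀ c : ENNReal, c ≠ ⊤ → IsCompact {y : ℝ | I y ≤ c})
    (hupper : ∀ a : ℝ → ℝ, ModerateScale a → ∀ F : Set ℝ, IsClosed F →
      Filter.limsup
        (fun t => ((t / (a t) ^ 2 : ℝ) : EReal) *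
          ENNReal.log (P {ω | ((1 / a t) * ∫ s in (0 : ℝ)..t, (A (Xbar s ω) - m)) ∈ F}))
        atTop ≤ -(⨅ y ∈ F, (I y : EReal)))
    (hexp : ∃ δ > (0 : ℝ),
      (∫⁻ ω, EReal.exp ((δ : EReal) *
          ((∫⁻ s in Set.Ioi (0 : ℝ), ENNReal.ofReal ‖X s ω - Xbar s ω‖) : EReal)) ∂P) < ⊤) :
    ∀ a : ℝ → ℝ, ModerateScale a → ∀ F : Set ℝ, IsClosed F →
      Filter.limsup
        (fun t => ((t / (a t) ^ 2 : ℝ) : EReal) *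
          ENNReal.log (P {ω | ((1 / a t) * ∫ s in (0 : ℝ)..t, (A (X s ω) - m)) ∈ F}))
        atTop ≤ -(⨅ y ∈ F, (I y : EReal)) := by
  intro a ha F hF
  obtain ⟨δ, hδ, hexp⟩ := hexp
  have hZ : Measurable fun ω => ∫⁻ s in Set.Ioi (0 : ℝ), ENNReal.ofReal ‖X s ω - Xbar s ω‖ :=
    (ENNReal.measurable_ofReal.comp (hX.sub hXbar).norm).lintegral_prod_left'
  obtain ⟨b, hb⟩ := measure_gt_le_exp hZ hδ hexp
  refine EReal.le_of_forall_lt_iff_le.1 fun c' hc' => ?_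
  obtain ⟨c, hc, hcc'⟩ := EReal.lt_iff_exists_real_btwn.1 hc'
  obtain ⟨c₀, hc₀, hc₀c⟩ := EReal.lt_iff_exists_real_btwn.1 hc
  obtain ⟨η, hη, hle⟩ := exists_le_iInf_cthickening hI_good hF hc₀
  have hs : ∀ᶠ t in atTop, 0 < t / a t ^ 2 := by
    filter_upwards [eventually_gt_atTop 0] with t ht
    have := ha.1 t ht
    positivity
  have hlim := ((hupper a ha _ Metric.isClosed_cthickening).trans hle).trans_lt hc₀c
  have hK : (0 : ℝ) < K + 1 := by positivity
  refine limsup_le_of_le (h := eventually_log_le_of_le_add hs ha.tendsto_speed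
    (EReal.coe_lt_coe_iff.1 hcc') (q := fun t => P {ω | ((1 / a t) *
      ∫ s in (0 : ℝ)..t, (A (Xbar s ω) - m)) ∈ Metric.cthickening η F})
    (r := fun t => P {ω | ENNReal.ofReal (η * a t / (K + 1)) <
      ∫⁻ s in Set.Ioi (0 : ℝ), ENNReal.ofReal ‖X s ω - Xbar s ω‖}) ?_ ?_ ?_)
  · filter_upwards [eventually_lt_of_limsup_lt hlim, hs] with t ht hst
    exact (coe_mul_log_le_iff hst _).1 ht.le
  · filter_upwards [ha.eventually_sub_le b c (κ := δ * η / (K + 1)) (by positivity),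
      eventually_gt_atTop 0] with t ht htpos
    have hat := ha.1 t htpos
    refine (hb _ (by positivity)).trans (ENNReal.ofReal_le_ofReal (Real.exp_le_exp.2 ?_))
    refine le_trans (le_of_eq ?_) ht
    ring
  · filter_upwards [eventually_gt_atTop 0] with t htpos
    have hat := ha.1 t htpos
    refine (measure_mono fun ω hω => ?_).trans (measure_union_le _ _)
    rw [Set.mem_union, Set.mem_ofPred_eq, Set.mem_ofPred_eq, or_iff_not_imp_right, not_lt]
    intro hle
    have hdiff := abs_integral_sub_le_of_lintegral_le hA m
      (hX.comp measurable_prodMk_right) (hXbar.comp measurable_prodMk_right)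
      htpos.le (by positivity) hle
    refine Metric.mem_cthickening_of_dist_le _ _ _ _ hω ?_
    rw [dist_comm, Real.dist_eq, ← mul_sub, abs_mul, abs_of_pos (by positivity), one_div,
      inv_mul_le_iff₀ hat, mul_comm (a t)]
    refine hdiff.trans ?_
    rw [← mul_div_assoc, div_le_iff₀ hK]
    nlinarith [mul_pos hη hat]
end

section
/- Let (Ω, F, P) be a probability space and let X, X̄ : [0,∞) × Ω → ℝ^d be jointly measurable stochastic processes. Let A : ℝ^d → ℝ be Lipschitz continuous, let m ∈ ℝ, and for a moderate scale function a set l_t^A := (1/a(t)) ∫₀ᵗ (A(X_s) − m) ds and l̄_t^A := (1/a(t)) ∫₀ᵗ (A(X̄_s) − m) ds. Let I : ℝ → [0,∞] be a good rate function. Assume: (i) for every moderate scale function a and every open set G ⊆ ℝ, liminf_{t→∞} (t / a(t)²) · log P(l̄_t^A ∈ G) ≥ − inf_{y∈G} I(y); (ii) there exists δ > 0 such that E[ exp( δ ∫₀^∞ |X_s − X̄_s| ds ) ] < ∞. Then for every moderate scale function a and every open set G ⊆ ℝ, liminf_{t→∞} (t / a(t)²) · log P(l_t^A ∈ G) ≥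 − inf_{y∈G} I(y). -/
open Filter MeasureTheory Topology

theorem norm_integral_sub_integral_le {α E : Type*} [MeasurableSpace α] [NormedAddCommGroup E]
    [NormedSpace ℝ E] {μ : Measure α} {f g : α → E}
    (hfg : Integrable (fun x => f x - g x) μ) :
    ‖∫ x, f x ∂μ - ∫ x, g x ∂μ‖ ≤ ∫ x, ‖f x - g x‖ ∂μ := by
  by_cases hg : Integrable g μ
  · have hf : Integrable f μ := (hfg.add hg).congr (ae_of_all _ fun x => sub_add_cancel _ _)
    rw [← integral_sub hf hg]
    exact norm_integral_le_integral_norm _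
  · have hf : ¬ Integrable f μ := fun hf =>
      hg ((hf.sub hfg).congr (ae_of_all _ fun x => sub_sub_cancel _ _))
    rw [integral_undef hf, integral_undef hg, sub_zero, norm_zero]
    exact integral_nonneg fun x => norm_nonneg _

theorem LipschitzWith.abs_integral_comp_sub_le {E : Type*} [NormedAddCommGroup E]
    [MeasurableSpace E] [BorelSpace E] [SecondCountableTopology E]
    {A : E → ℝ} {K : NNReal} (hA : LipschitzWith K A) (m : ℝ) {x y : ℝ → E}
    (hx : Measurable x) (hy : Measurable y) {t u : ℝ} (ht : 0 ≤ t)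
    (hu : (∫⁻ s in Set.Ioi (0 : ℝ), ENNReal.ofReal ‖x s - y s‖) < ENNReal.ofReal u) :
    |(∫ s in (0 : ℝ)..t, (A (x s) - m)) - ∫ s in (0 : ℝ)..t, (A (y s) - m)| ≤ K * u := by
  have hu0 : 0 < u := ENNReal.ofReal_pos.1 (lt_of_le_of_lt zero_le hu)
  have hint : IntegrableOn (fun s => ‖x s - y s‖) (Set.Ioi 0) := by
    refine ⟨(hx.sub hy).norm.aestronglyMeasurable, ?_⟩
    rw [hasFiniteIntegral_iff_ofReal (ae_of_all _ fun s => norm_nonneg _)]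
    exact hu.trans ENNReal.ofReal_lt_top
  have hint' : IntegrableOn (fun s => ‖x s - y s‖) (Set.Ioc 0 t) :=
    hint.mono_set Set.Ioc_subset_Ioi_self
  have hlip : ∀ s, ‖(A (x s) - m) - (A (y s) - m)‖ ≤ K * ‖x s - y s‖ := fun s => by
    have := hA.dist_le_mul (x s) (y s)
    rwa [dist_eq_norm, dist_eq_norm, ← sub_sub_sub_cancel_right _ _ m] at this
  have hdiff : IntegrableOn (fun s => (A (x s) - m) - (A (y s) - m)) (Set.Ioc 0 t) := by
    refine (hint'.const_mul (K : ℝ)).mono' ?_ (ae_of_all _ hlip)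
    have hAm : Measurable A := hA.continuous.measurable
    exact (((hAm.comp hx).sub_const m).sub ((hAm.comp hy).sub_const m)).aestronglyMeasurable
  rw [intervalIntegral.integral_of_le ht, intervalIntegral.integral_of_le ht, ← Real.norm_eq_abs]
  calc _ ≤ ∫ s in Set.Ioc 0 t, ‖(A (x s) - m) - (A (y s) - m)‖ :=
        norm_integral_sub_integral_le hdiff
    _ ≤ ∫ s in Set.Ioc 0 t, K * ‖x s - y s‖ :=
        integral_mono hdiff.norm (hint'.const_mul (K : ℝ)) hlip
    _ = K * ∫ s in Set.Ioc 0 t, ‖x s - y s‖ := integral_const_mul _ _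
    _ ≤ K * ∫ s in Set.Ioi 0, ‖x s - y s‖ := by
        gcongr ?_ * ?_
        exact setIntegral_mono_set hint (ae_of_all _ fun s => norm_nonneg _)
          (ae_of_all _ Set.Ioc_subset_Ioi_self)
    _ ≤ K * u := by
        gcongr
        rw [integral_eq_lintegral_of_nonneg_ae (ae_of_all _ fun s => norm_nonneg _)
          hint.aestronglyMeasurable]
        exact ENNReal.toReal_le_of_le_ofReal hu0.le hu.le

theorem EReal.coe_lt_mul_ennrealLog_iff {x : ENNReal} (hx : x ≠ ⊤) {r : ℝ} (hr : 0 < r) (c : ℝ) :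
    (c : EReal) < (r : EReal) * ENNReal.log x ↔ Real.exp (c / r) < x.toReal := by
  rcases eq_or_ne x 0 with rfl | h0
  · simp [EReal.coe_mul_bot_of_pos hr, (Real.exp_pos _).le]
  · rw [ENNReal.log_pos_real h0 hx, ← EReal.coe_mul, EReal.coe_lt_coe_iff,
      ← Real.lt_log_iff_exp_lt (ENNReal.toReal_pos h0 hx), div_lt_iff₀ hr, mul_comm]

/-- The exponential Markov inequality for a variable with values in `[0, ∞]`. -/
theorem measureReal_ofReal_le_le_lintegral_exp {Ω : Type*} [MeasurableSpace Ω] {P : Measure Ω}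
    {D : Ω → ENNReal} (hD : Measurable D) {δ : ℝ} (hδ : 0 < δ)
    (h : (∫⁻ ω, EReal.exp ((δ : EReal) * (D ω : EReal)) ∂P) < ⊤) {u : ℝ} (hu : 0 ≤ u) :
    P.real {ω | ENNReal.ofReal u ≤ D ω} ≤
      (∫⁻ ω, EReal.exp ((δ : EReal) * (D ω : EReal)) ∂P).toReal * Real.exp (-(δ * u)) := by
  have hmeas : Measurable fun ω => EReal.exp ((δ : EReal) * (D ω : EReal)) := by
    fun_prop
  have hsub : {ω | ENNReal.ofReal u ≤ D ω} ⊆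
      {ω | ENNReal.ofReal (Real.exp (δ * u)) ≤ EReal.exp ((δ : EReal) * (D ω : EReal))} := by
    intro ω hω
    simp only [Set.mem_ofPred_eq] at hω ⊢
    rw [← EReal.exp_coe, EReal.exp_le_exp_iff, EReal.coe_mul]
    gcongr
    have : ((ENNReal.ofReal u : ENNReal) : EReal) ≤ (D ω : EReal) := by exact_mod_cast hω
    rwa [EReal.coe_ennreal_ofReal, max_eq_left hu] at this
  have hmarkov := (mul_le_mul_right (measure_mono hsub) _).trans
    (mul_meas_ge_le_lintegral (μ := P) hmeas (ENNReal.ofReal (Real.exp (δ * u))))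
  have := ENNReal.toReal_mono h.ne hmarkov
  rw [ENNReal.toReal_mul, ENNReal.toReal_ofReal (Real.exp_pos _).le] at this
  rw [Real.exp_neg, ← div_eq_mul_inv, le_div_iff₀ (Real.exp_pos _), mul_comm]
  exact this

theorem ModerateScale.tendsto_atTop {a : ℝ → ℝ} (ha : ModerateScale a) :
    Tendsto a atTop atTop := by
  refine tendsto_atTop_mono' _ ?_ Real.tendsto_sqrt_atTop
  filter_upwards [ha.2.1.eventually_lt_const one_pos, eventually_gt_atTop 0] with t h ht
  exact ((div_lt_one (ha.1 t ht)).1 h).le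

theorem ModerateScale.tendsto_speed_s3 {a : ℝ → ℝ} (ha : ModerateScale a) :
    Tendsto (fun t => t / a t ^ 2) atTop (𝓝 0) := by
  have h := ha.2.1.pow 2
  rw [zero_pow two_ne_zero] at h
  refine h.congr' ?_
  filter_upwards [eventually_ge_atTop 0] with t ht
  rw [div_pow, Real.sq_sqrt ht]

/-- Errors of order `exp (-κ a(t))` are negligible at the moderate deviation speed. -/
theorem ModerateScale.eventually_mul_exp_lt {a : ℝ → ℝ} (ha : ModerateScale a) (C c : ℝ) {κ : ℝ}
    (hκ : 0 < κ) :
    ∀ᶠ t in atTop, C * Real.exp (-(κ * a t)) < Real.exp (c / (t / a t ^ 2)) / 2 := by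
  have h1 : Tendsto (fun t => κ + c * (a t / t)) atTop (𝓝 κ) := by
    simpa using (ha.2.2.const_mul c).const_add κ
  have h2 : Tendsto (fun t => C * Real.exp (-(a t * (κ + c * (a t / t))))) atTop (𝓝 0) := by
    simpa using (Real.tendsto_exp_neg_atTop_nhds_zero.comp
      (ha.tendsto_atTop.atTop_mul_pos hκ h1)).const_mul C
  filter_upwards [h2.eventually_lt_const (half_pos one_pos), eventually_gt_atTop 0] with t h ht
  have hat := ha.1 t ht
  have hexp : Real.exp (-(κ * a t)) =
      Real.exp (-(a t * (κ + c * (a t / t)))) * Real.exp (c / (t / a t ^ 2)) := by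
    rw [← Real.exp_add]
    congr 1
    field_simp
    ring
  rw [hexp, ← mul_assoc]
  have := mul_lt_mul_of_pos_right h (Real.exp_pos (c / (t / a t ^ 2)))
  linarith

theorem stmt_3
    {Ω : Type*} [MeasurableSpace Ω] (P : Measure Ω) [IsProbabilityMeasure P]
    (d : ℕ)
    (X Xbar : ℝ → Ω → EuclideanSpace ℝ (Fin d))
    (hX : Measurable (Function.uncurry X)) (hXbar : Measurable (Function.uncurry Xbar))
    (A : EuclideanSpace ℝ (Fin d) → ℝ) (K : NNReal) (hA : LipschitzWith K A)
    (m : ℝ)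
    (I : ℝ → ENNReal) (hI_lsc : LowerSemicontinuous I)
    (hI_good : ∀ c : ENNReal, c ≠ ⊤ → IsCompact {y : ℝ | I y ≤ c})
    (hlower : ∀ a : ℝ → ℝ, ModerateScale a → ∀ G : Set ℝ, IsOpen G →
      -(⨅ y ∈ G, (I y : EReal)) ≤
        Filter.liminf
          (fun t => ((t / (a t) ^ 2 : ℝ) : EReal) *
            ENNReal.log (P {ω | ((1 / a t) * ∫ s in (0 : ℝ)..t, (A (Xbar s ω) - m)) ∈ G}))
          atTop)
    (hexp : ∃ δ > (0 : ℝ),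
      (∫⁻ ω, EReal.exp ((δ : EReal) *
          ((∫⁻ s in Set.Ioi (0 : ℝ), ENNReal.ofReal ‖X s ω - Xbar s ω‖) : EReal)) ∂P) < ⊤) :
    ∀ a : ℝ → ℝ, ModerateScale a → ∀ G : Set ℝ, IsOpen G →
      -(⨅ y ∈ G, (I y : EReal)) ≤
        Filter.liminf
          (fun t => ((t / (a t) ^ 2 : ℝ) : EReal) *
            ENNReal.log (P {ω | ((1 / a t) * ∫ s in (0 : ℝ)..t, (A (X s ω) - m)) ∈ G}))
          atTop := by
  intro a ha G hG
  obtain ⟨δ, hδ, hM⟩ := hexp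
  set D : Ω → ENNReal := fun ω => ∫⁻ s in Set.Ioi (0 : ℝ), ENNReal.ofReal ‖X s ω - Xbar s ω‖
  have hD : Measurable D := by
    refine Measurable.lintegral_prod_left' (f := fun p : ℝ × Ω =>
      ENNReal.ofReal ‖X p.1 p.2 - Xbar p.1 p.2‖) ?_
    exact (hX.sub hXbar).norm.ennreal_ofReal
  rw [EReal.neg_le]
  refine le_iInf₂ fun y hy => ?_
  rw [EReal.neg_le]
  refine le_of_forall_lt fun b hb => ?_
  obtain ⟨c, hbc, hc⟩ := EReal.lt_iff_exists_real_btwn.1 hb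
  obtain ⟨c', hcc', hc'⟩ := EReal.lt_iff_exists_real_btwn.1 hc
  rw [EReal.coe_lt_coe_iff] at hcc'
  refine hbc.trans_le (le_liminf_of_le (by isBoundedDefault) ?_)
  obtain ⟨r, hr, hball⟩ := Metric.isOpen_iff.1 hG y hy
  set ε := r / 2 with hε
  have hε0 : 0 < ε := half_pos hr
  have hK : (0 : ℝ) < K + 1 := by positivity
  have hbar : ∀ᶠ t in atTop, (c' : EReal) < ((t / (a t) ^ 2 : ℝ) : EReal) *
      ENNReal.log (P {ω | ((1 / a t) * ∫ s in (0 : ℝ)..t, (A (Xbar s ω) - m)) ∈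
        Metric.ball y ε}) := by
    refine eventually_lt_of_lt_liminf (hc'.trans_le (le_trans ?_
      (hlower a ha (Metric.ball y ε) Metric.isOpen_ball))) (by isBoundedDefault)
    exact EReal.neg_le_neg_iff.2 (iInf₂_le y (Metric.mem_ball_self hε0))
  have hκ : 0 < δ * (ε / (K + 1)) := by positivity
  have hspeed := (ha.tendsto_speed_s3.mul_const (Real.log 2)).eventually_lt_const
    (show 0 * Real.log 2 < c' - c by linarith)
  filter_upwards [hbar, hspeed, eventually_gt_atTop 0, ha.eventually_mul_exp_lt
    (∫⁻ ω, EReal.exp ((δ : EReal) * (D ω : EReal)) ∂P).toReal c' hκ] with t hbar hspeed ht herr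
  have hat := ha.1 t ht
  have hr0 : 0 < t / a t ^ 2 := by positivity
  rw [EReal.coe_lt_mul_ennrealLog_iff (measure_ne_top P _) hr0] at hbar
  refine le_of_lt ((EReal.coe_lt_mul_ennrealLog_iff (measure_ne_top P _) hr0 c).2 ?_)
  set u := ε / (K + 1) * a t with hu
  have hu0 : 0 < u := by positivity
  have hsub : {ω | ((1 / a t) * ∫ s in (0 : ℝ)..t, (A (Xbar s ω) - m)) ∈ Metric.ball y ε} ⊆
      {ω | ((1 / a t) * ∫ s in (0 : ℝ)..t, (A (X s ω) - m)) ∈ G} ∪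
        {ω | ENNReal.ofReal u ≤ D ω} := by
    intro ω hω
    refine or_iff_not_imp_right.2 fun hDω => hball ?_
    simp only [Set.mem_ofPred_eq, not_le] at hDω
    have hdiff := hA.abs_integral_comp_sub_le m (hX.comp measurable_prodMk_right)
      (hXbar.comp measurable_prodMk_right) ht.le hDω
    simp only [Function.comp_apply, Function.uncurry_apply_pair] at hdiff
    have hKu : K * u ≤ ε * a t := by
      rw [hu, ← mul_assoc, mul_div_assoc']
      gcongr
      rw [div_le_iff₀ hK]
      nlinarith
    have hclose : dist ((1 / a t) * ∫ s in (0 : ℝ)..t, (A (X s ω) - m))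
        ((1 / a t) * ∫ s in (0 : ℝ)..t, (A (Xbar s ω) - m)) ≤ ε := by
      rw [Real.dist_eq, ← mul_sub, abs_mul, abs_of_pos (by positivity : 0 < 1 / a t),
        one_div_mul_eq_div, div_le_iff₀ hat]
      exact hdiff.trans hKu
    have hω' := Metric.mem_ball.1 (Set.mem_ofPred_eq ▸ hω)
    rw [Metric.mem_ball]
    linarith [dist_triangle ((1 / a t) * ∫ s in (0 : ℝ)..t, (A (X s ω) - m))
      ((1 / a t) * ∫ s in (0 : ℝ)..t, (A (Xbar s ω) - m)) y]
  have hunion := (measureReal_mono (μ := P) hsub).trans (measureReal_union_le _ _)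
  have htail := measureReal_ofReal_le_le_lintegral_exp hD hδ hM hu0.le
  rw [hu, ← mul_assoc] at htail
  have hlog : Real.exp (c / (t / a t ^ 2)) < Real.exp (c' / (t / a t ^ 2)) / 2 := by
    rw [lt_div_iff₀ two_pos]
    nth_rewrite 1 [← Real.exp_log two_pos]
    rw [← Real.exp_add, Real.exp_lt_exp, lt_div_iff₀ hr0, add_mul, div_mul_cancel₀ _ hr0.ne']
    linarith
  simp only [measureReal_def] at hunion htail
  linarith
end

section
/- Let (Ω, F, P) be a probability space and let X, X̄ : [0,∞) × Ω → ℝ^d be jointly measurable stochastic processes. Let α ∈ (0,1), K ≥ 0, and let A : ℝ^d → ℝ satisfy |A(x) − A(y)| ≤ K · |x − y|^α · (1 + |x| + |y|)^{2−α} for all x, y ∈ ℝ^d. Let m ∈ ℝ, and for a moderate scale function a set l_t^A := (1/a(t)) ∫₀ᵗ (A(X_s) − m) ds and l̄_t^A := (1/a(t)) ∫₀ᵗ (A(X̄_s) − m) ds. Let I : ℝ → [0,∞] be a good rate function. Assume: (i) for every moderate scale function a and every open set G ⊆ ℝ, liminf_{t→∞} (t / a(t)²) · log P(l̄_t^A ∈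 G) ≥ − inf_{y∈G} I(y); (ii) there exists δ > 0 such that E[ exp( δ ∫₀^∞ |X_s − X̄_s|^α (1 + |X_s| + |X̄_s|)^{2−α} ds ) ] < ∞. Then for every moderate scale function a and every open set G ⊆ ℝ, liminf_{t→∞} (t / a(t)²) · log P(l_t^A ∈ G) ≥ − inf_{y∈G} I(y). -/
open Filter MeasureTheory Topology

lemma log_ofReal_exp (x : ℝ) : ENNReal.log (ENNReal.ofReal (Real.exp x)) = (x : EReal) := by
  rw [← EReal.exp_coe, EReal.log_exp]

lemma mul_log_ofReal_exp {s : ℝ} (hs : 0 < s) (c : ℝ) :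
    (s : EReal) * ENNReal.log (ENNReal.ofReal (Real.exp (-c / s))) = ((-c : ℝ) : EReal) := by
  rw [log_ofReal_exp, ← EReal.coe_mul, mul_div_cancel₀ _ hs.ne']

lemma ofReal_exp_lt_of_lt_mul_log {s : ℝ} (hs : 0 < s) {c : ℝ} {p : ENNReal}
    (h : ((-c : ℝ) : EReal) < (s : EReal) * ENNReal.log p) :
    ENNReal.ofReal (Real.exp (-c / s)) < p := by
  by_contra! hp
  refine h.not_ge ?_
  rw [← mul_log_ofReal_exp hs c]
  exact mul_le_mul_of_nonneg_left (ENNReal.log_monotone hp) (by exact_mod_cast hs.le)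

lemma le_mul_log_of_ofReal_exp_le {s : ℝ} (hs : 0 < s) {c : ℝ} {p : ENNReal}
    (h : ENNReal.ofReal (Real.exp (-c / s)) ≤ p) :
    ((-c : ℝ) : EReal) ≤ (s : EReal) * ENNReal.log p := by
  rw [← mul_log_ofReal_exp hs c]
  exact mul_le_mul_of_nonneg_left (ENNReal.log_monotone h) (by exact_mod_cast hs.le)

lemma continuous_of_abs_sub_le_rpow {E : Type*} [NormedAddCommGroup E] {α β K : ℝ} (hα : 0 < α)
    {A : E → ℝ} (hA : ∀ x y, |A x - A y| ≤ K * ‖x - y‖ ^ α * (1 + ‖x‖ + ‖y‖) ^ β) :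
    Continuous A := by
  rw [continuous_iff_continuousAt]
  intro y
  rw [ContinuousAt, tendsto_iff_norm_sub_tendsto_zero]
  refine squeeze_zero (fun _ => norm_nonneg _) (fun x => hA x y) ?_
  have hc : ContinuousAt (fun x => K * ‖x - y‖ ^ α * (1 + ‖x‖ + ‖y‖) ^ β) y := by
    refine (continuousAt_const.mul ?_).mul ?_
    · exact ContinuousAt.rpow_const (by fun_prop) (Or.inr hα.le)
    · exact ContinuousAt.rpow_const (by fun_prop) (Or.inl (by positivity))
  simpa [ContinuousAt, Real.zero_rpow hα.ne'] using hc

/-- If two functions differ by at most `K * h`, their Bochner integrals differ by at most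
`K * r` as soon as `∫⁻ h ≤ r`; no integrability of the functions themselves is needed. -/
lemma abs_integral_sub_integral_le {S : Type*} [MeasurableSpace S] {μ : Measure S}
    {f g h : S → ℝ} (hf : AEStronglyMeasurable f μ) (hg : AEStronglyMeasurable g μ)
    {K r : ℝ} (hK : 0 ≤ K) (hr : 0 ≤ r) (hfg : ∀ s, |f s - g s| ≤ K * h s)
    (hh : ∫⁻ s, ENNReal.ofReal (h s) ∂μ ≤ ENNReal.ofReal r) :
    |∫ s, f s ∂μ - ∫ s, g s ∂μ| ≤ K * r := by
  have hb : ∫⁻ s, ‖f s - g s‖ₑ ∂μ ≤ ENNReal.ofReal (K * r) := by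
    calc ∫⁻ s, ‖f s - g s‖ₑ ∂μ
        ≤ ∫⁻ s, ENNReal.ofReal K * ENNReal.ofReal (h s) ∂μ := by
          refine lintegral_mono fun s => ?_
          rw [← ENNReal.ofReal_mul hK, Real.enorm_eq_ofReal_abs]
          exact ENNReal.ofReal_le_ofReal (hfg s)
      _ = ENNReal.ofReal K * ∫⁻ s, ENNReal.ofReal (h s) ∂μ :=
          lintegral_const_mul' _ _ ENNReal.ofReal_ne_top
      _ ≤ ENNReal.ofReal (K * r) := by
          rw [ENNReal.ofReal_mul hK]
          gcongr
  have hd : Integrable (fun s => f s - g s) μ := ⟨hf.sub hg, hb.trans_lt ENNReal.ofReal_lt_top⟩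
  by_cases hi : Integrable g μ
  · have hfi : Integrable f μ := (hd.add hi).congr (by simp [Filter.EventuallyEq])
    rw [← integral_sub hfi hi, ← Real.norm_eq_abs,
      ← ENNReal.ofReal_le_ofReal_iff (by positivity), ofReal_norm]
    exact (enorm_integral_le_lintegral_enorm _).trans hb
  · have hfi : ¬ Integrable f μ := fun hfi => hi ((hfi.sub hd).congr (by simp [Filter.EventuallyEq]))
    rw [integral_undef hi, integral_undef hfi]
    simpa using by positivity

/-- Exponential Markov inequality for `[0, ∞]`-valued functions. -/
lemma measure_lt_le_of_lintegral_exp {Ω : Type*} [MeasurableSpace Ω] {P : Measure Ω}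
    {H : Ω → ENNReal} (hH : Measurable H) {δ : ℝ} (hδ : 0 < δ)
    (hfin : ∫⁻ ω, EReal.exp ((δ : EReal) * (H ω : EReal)) ∂P < ⊤) (r : ℝ) (hr : 0 ≤ r) :
    P {ω | ENNReal.ofReal r < H ω} ≤
      ENNReal.ofReal ((∫⁻ ω, EReal.exp ((δ : EReal) * (H ω : EReal)) ∂P).toReal *
        Real.exp (-(δ * r))) := by
  set C := ∫⁻ ω, EReal.exp ((δ : EReal) * (H ω : EReal)) ∂P
  have hm : Measurable fun ω => EReal.exp ((δ : EReal) * (H ω : EReal)) := by fun_prop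
  have hmark := mul_meas_ge_le_lintegral (μ := P) hm (ENNReal.ofReal (Real.exp (δ * r)))
  have hsub : P {ω | ENNReal.ofReal r < H ω} ≤
      P {ω | ENNReal.ofReal (Real.exp (δ * r)) ≤ EReal.exp ((δ : EReal) * (H ω : EReal))} := by
    refine measure_mono fun ω hω => ?_
    have hω' : (r : EReal) ≤ (H ω : EReal) := by
      have := EReal.coe_ennreal_le_coe_ennreal_iff.2 (le_of_lt hω)
      rwa [EReal.coe_ennreal_ofReal, max_eq_left hr] at this
    simp only [Set.mem_ofPred_eq]
    rw [← EReal.exp_coe, EReal.coe_mul]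
    exact EReal.exp_monotone (mul_le_mul_of_nonneg_left hω' (by exact_mod_cast hδ.le))
  rw [ENNReal.ofReal_mul ENNReal.toReal_nonneg, ENNReal.ofReal_toReal hfin.ne, Real.exp_neg,
    ENNReal.ofReal_inv_of_pos (Real.exp_pos _), ← div_eq_mul_inv]
  refine hsub.trans ?_
  rw [ENNReal.le_div_iff_mul_le (Or.inl (by simp [Real.exp_pos])) (Or.inl ENNReal.ofReal_ne_top),
    mul_comm]
  exact hmark

/-- At moderate scales, terms of size `exp (-κ a t)` are negligible compared with those of size
`exp (-c a t ^ 2 / t)`. -/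
lemma ModerateScale.eventually_exp_add_le {a : ℝ → ℝ} (ha : ModerateScale a) {c c' κ : ℝ}
    (hc : c < c') (hκ : 0 < κ) (C : ℝ) :
    ∀ᶠ t in atTop, Real.exp (-c' / (t / a t ^ 2)) + C * Real.exp (-(κ * a t)) ≤
      Real.exp (-c / (t / a t ^ 2)) := by
  obtain ⟨hpos, h1, h2⟩ := ha
  have hu : Tendsto (fun t => (a t) ^ 2 / t) atTop atTop := by
    have h3 : Tendsto (fun t => (Real.sqrt t / a t) ^ 2) atTop (𝓝[>] 0) := by
      refine tendsto_nhdsWithin_iff.2 ⟨by simpa using h1.pow 2, ?_⟩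
      filter_upwards [eventually_gt_atTop 0] with t ht
      have := hpos t ht
      have := Real.sqrt_pos.2 ht
      simp only [Set.mem_Ioi]
      positivity
    refine h3.inv_tendsto_nhdsGT_zero.congr' ?_
    filter_upwards [eventually_gt_atTop 0] with t ht
    simp [div_pow, Real.sq_sqrt ht.le]
  have hv : Tendsto (fun t => t / a t) atTop atTop := by
    have h3 : Tendsto (fun t => a t / t) atTop (𝓝[>] 0) := by
      refine tendsto_nhdsWithin_iff.2 ⟨h2, ?_⟩
      filter_upwards [eventually_gt_atTop 0] with t ht
      exact div_pos (hpos t ht) ht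
    exact h3.inv_tendsto_nhdsGT_zero.congr fun t => by simp
  have e1 : Tendsto (fun t => Real.exp (-((c' - c) * ((a t) ^ 2 / t)))) atTop (𝓝 0) :=
    Real.tendsto_exp_neg_atTop_nhds_zero.comp (hu.const_mul_atTop (sub_pos.2 hc))
  have e2 : Tendsto (fun t => Real.exp (-((a t) ^ 2 / t * (κ * (t / a t) + -c)))) atTop (𝓝 0) :=
    Real.tendsto_exp_neg_atTop_nhds_zero.comp
      (hu.atTop_mul_atTop₀ (tendsto_atTop_add_const_right _ _ (hv.const_mul_atTop hκ)))
  have e3 := e1.add (e2.const_mul C)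
  simp only [mul_zero, add_zero] at e3
  filter_upwards [e3.eventually (ge_mem_nhds one_pos), eventually_gt_atTop 0] with t ht ht0
  have hat := hpos t ht0
  have h4 := mul_le_mul_of_nonneg_right ht (Real.exp_pos (-c / (t / a t ^ 2))).le
  rw [add_mul, mul_assoc, ← Real.exp_add, ← Real.exp_add, one_mul] at h4
  have h5 : -((c' - c) * (a t ^ 2 / t)) + -c / (t / a t ^ 2) = -c' / (t / a t ^ 2) := by
    field_simp
    ring
  have h6 : -(a t ^ 2 / t * (κ * (t / a t) + -c)) + -c / (t / a t ^ 2) = -(κ * a t) := by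
    field_simp
    ring
  rwa [h5, h6] at h4

theorem stmt_5
    {Ω : Type*} [MeasurableSpace Ω] (P : Measure Ω) [IsProbabilityMeasure P]
    (d : ℕ)
    (X Xbar : ℝ → Ω → EuclideanSpace ℝ (Fin d))
    (hX : Measurable (Function.uncurry X)) (hXbar : Measurable (Function.uncurry Xbar))
    (α : ℝ) (hα : α ∈ Set.Ioo (0 : ℝ) 1) (K : ℝ) (hK : 0 ≤ K)
    (A : EuclideanSpace ℝ (Fin d) → ℝ)
    (hA : ∀ x y : EuclideanSpace ℝ (Fin d),
      |A x - A y| ≤ K * ‖x - y‖ ^ α * (1 + ‖x‖ + ‖y‖) ^ (2 - α))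
    (m : ℝ)
    (I : ℝ → ENNReal) (hI_lsc : LowerSemicontinuous I)
    (hI_good : ∀ c : ENNReal, c ≠ ⊤ → IsCompact {y : ℝ | I y ≤ c})
    (hlower : ∀ a : ℝ → ℝ, ModerateScale a → ∀ G : Set ℝ, IsOpen G →
      -(⨅ y ∈ G, (I y : EReal)) ≤
        Filter.liminf
          (fun t => ((t / (a t) ^ 2 : ℝ) : EReal) *
            ENNReal.log (P {ω | ((1 / a t) * ∫ s in (0 : ℝ)..t, (A (Xbar s ω) - m)) ∈ G}))
          atTop)
    (hexp : ∃ δ > (0 : ℝ),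
      (∫⁻ ω, EReal.exp ((δ : EReal) *
          ((∫⁻ s in Set.Ioi (0 : ℝ),
            ENNReal.ofReal (‖X s ω - Xbar s ω‖ ^ α *
              (1 + ‖X s ω‖ + ‖Xbar s ω‖) ^ (2 - α))) : EReal)) ∂P) < ⊤) :
    ∀ a : ℝ → ℝ, ModerateScale a → ∀ G : Set ℝ, IsOpen G →
      -(⨅ y ∈ G, (I y : EReal)) ≤
        Filter.liminf
          (fun t => ((t / (a t) ^ 2 : ℝ) : EReal) *
            ENNReal.log (P {ω | ((1 / a t) * ∫ s in (0 : ℝ)..t, (A (X s ω) - m)) ∈ G}))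
          atTop := by
  intro a ha G hG
  obtain ⟨δ, hδ, hfin⟩ := hexp
  set H : Ω → ENNReal := fun ω => ∫⁻ s in Set.Ioi (0 : ℝ),
    ENNReal.ofReal (‖X s ω - Xbar s ω‖ ^ α * (1 + ‖X s ω‖ + ‖Xbar s ω‖) ^ (2 - α))
  have hH : Measurable H := by
    have hX' : Measurable fun q : Ω × ℝ => X q.2 q.1 := hX.comp measurable_swap
    have hXbar' : Measurable fun q : Ω × ℝ => Xbar q.2 q.1 := hXbar.comp measurable_swap
    refine Measurable.lintegral_prod_right' (f := fun q : Ω × ℝ =>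
      ENNReal.ofReal (‖X q.2 q.1 - Xbar q.2 q.1‖ ^ α *
        (1 + ‖X q.2 q.1‖ + ‖Xbar q.2 q.1‖) ^ (2 - α))) ?_
    fun_prop
  have hAm : Measurable A := (continuous_of_abs_sub_le_rpow hα.1 hA).measurable
  refine le_of_forall_lt fun z hz => ?_
  rw [EReal.lt_neg_comm] at hz
  simp only [iInf_lt_iff] at hz
  obtain ⟨y, hy, hyz⟩ := hz
  obtain ⟨c, hyc, hcz⟩ := EReal.lt_iff_exists_real_btwn.1 hyz
  obtain ⟨c', hcc', hcz'⟩ := EReal.lt_iff_exists_real_btwn.1 hcz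
  refine (EReal.lt_neg_comm.1 hcz').trans_le ?_
  obtain ⟨ε, hε, hεG⟩ := Metric.isOpen_iff.1 hG y hy
  have hlow : ((-c : ℝ) : EReal) < -(⨅ x ∈ Metric.ball y (ε / 2), (I x : EReal)) := by
    rw [EReal.coe_neg, EReal.neg_lt_neg_iff]
    exact (iInf₂_le y (Metric.mem_ball_self (half_pos hε))).trans_lt hyc
  rw [← EReal.coe_neg]
  refine le_liminf_of_le (by isBoundedDefault) ?_
  have hK1 : 0 < K + 1 := by linarith
  have hκ : 0 < δ * (ε / 2 / (K + 1)) := by positivity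
  filter_upwards [eventually_lt_of_lt_liminf
      (hlow.trans_le (hlower a ha _ Metric.isOpen_ball)) (by isBoundedDefault), eventually_gt_atTop 0,
    ha.eventually_exp_add_le (EReal.coe_lt_coe_iff.1 hcc') hκ
      (∫⁻ ω, EReal.exp ((δ : EReal) * (H ω : EReal)) ∂P).toReal] with t h1 ht h2
  have hat := ha.1 t ht
  have hs : 0 < t / a t ^ 2 := by positivity
  refine le_mul_log_of_ofReal_exp_le hs ?_
  have h3 := ofReal_exp_lt_of_lt_mul_log hs h1
  set r := ε / 2 / (K + 1) * a t with hr
  have hr0 : 0 ≤ r := by positivity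
  have h4 := measure_lt_le_of_lintegral_exp hH hδ hfin r hr0
  have hsub : {ω | ((1 / a t) * ∫ s in (0 : ℝ)..t, (A (Xbar s ω) - m)) ∈ Metric.ball y (ε / 2)} ⊆
      {ω | ((1 / a t) * ∫ s in (0 : ℝ)..t, (A (X s ω) - m)) ∈ G} ∪
        {ω | ENNReal.ofReal r < H ω} := by
    intro ω hω
    by_contra hcon
    simp only [Set.mem_union, Set.mem_ofPred_eq, not_or, not_lt] at hcon
    refine hcon.1 (hεG ?_)
    have hXω : Measurable fun s => X s ω := hX.comp measurable_prodMk_right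
    have hXbω : Measurable fun s => Xbar s ω := hXbar.comp measurable_prodMk_right
    have hdiff := abs_integral_sub_integral_le (μ := volume.restrict (Set.Ioc 0 t))
      (f := fun s => A (X s ω) - m) (g := fun s => A (Xbar s ω) - m)
      (h := fun s => ‖X s ω - Xbar s ω‖ ^ α * (1 + ‖X s ω‖ + ‖Xbar s ω‖) ^ (2 - α))
      ((hAm.comp hXω).sub_const m).aestronglyMeasurable
      ((hAm.comp hXbω).sub_const m).aestronglyMeasurable hK hr0
      (fun s => by rw [sub_sub_sub_cancel_right, ← mul_assoc]; exact hA _ _)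
      ((lintegral_mono_set Set.Ioc_subset_Ioi_self).trans hcon.2)
    rw [← intervalIntegral.integral_of_le ht.le, ← intervalIntegral.integral_of_le ht.le] at hdiff
    rw [Set.mem_ofPred_eq, Metric.mem_ball, Real.dist_eq] at hω
    rw [Metric.mem_ball, Real.dist_eq]
    set U := ∫ s in (0 : ℝ)..t, (A (X s ω) - m)
    set V := ∫ s in (0 : ℝ)..t, (A (Xbar s ω) - m)
    have h5 : |1 / a t * U - 1 / a t * V| ≤ ε / 2 := by
      rw [← mul_sub, abs_mul, abs_of_pos (by positivity), one_div, inv_mul_le_iff₀ hat]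
      refine hdiff.trans ?_
      have : (K + 1) * r = a t * (ε / 2) := by rw [hr]; field_simp
      linarith
    calc |1 / a t * U - y| ≤ |1 / a t * U - 1 / a t * V| + |1 / a t * V - y| := abs_sub_le _ _ _
      _ < ε := by linarith
  have h6 := (measure_mono hsub).trans (measure_union_le (μ := P) _ _)
  have h7 := h3.le.trans (h6.trans (add_le_add_right h4 _))
  have h8 := (ENNReal.ofReal_le_ofReal h2).trans h7
  rw [ENNReal.ofReal_add (by positivity) (by positivity), hr, ← mul_assoc δ] at h8
  exact (ENNReal.add_le_add_iff_right ENNReal.ofReal_ne_top).1 h8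
end

section
/- Let (Ω, F, P) be a probability space and let X, X̄ : [0,∞) × Ω → ℝ^d be jointly measurable stochastic processes. Let p > 1, K ≥ 0, and let A : ℝ^d → ℝ be a measurable function satisfying |A(x) − A(y)| ≤ K · (1 + |x|² + |y|²) / ( log(e + |x|² + |y|²) · [log(e + |x − y|^{−1})]^p ) for all x ≠ y in ℝ^d. Let m ∈ ℝ and for a moderate scale function a set l_t^A := (1/a(t)) ∫₀ᵗ (A(X_s) − m) ds and l̄_t^A := (1/a(t)) ∫₀ᵗ (A(X̄_s) − m) ds. Assume there exists δ > 0 such that E[ exp( δ ∫₀^∞ Φ(X_s, X̄_s) ds ) ] < ∞, where Φ(x, y) := (1 + |x|² + |y|²) / ( log(e + |x|² + |y|²) · [log(e + |x − y|^{−1})]^p ) for x ≠ y and Φ(x, x) := 0. Then for every moderate scale function a and every ε > 0, lim_{t→∞} (t / a(t)²) · log P( |l_t^A − l̄_t^A| > ε ) = −∞. -/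
open Filter MeasureTheory Topology
open scoped Classical

/-- `Φ(x, y) = (1 + |x|² + |y|²) / (log(e + |x|² + |y|²) · [log(e + |x − y|⁻¹)]^p)` for
`x ≠ y`, and `Φ(x, x) = 0`. -/
noncomputable def PhiAux {d : ℕ} (p : ℝ) (x y : EuclideanSpace ℝ (Fin d)) : ℝ :=
  if x = y then 0
  else (1 + ‖x‖ ^ 2 + ‖y‖ ^ 2) /
    (Real.log (Real.exp 1 + ‖x‖ ^ 2 + ‖y‖ ^ 2) *
      Real.log (Real.exp 1 + ‖x - y‖⁻¹) ^ p)

theorem measurable_PhiAux {d : ℕ} (p : ℝ) :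
    Measurable (fun z : EuclideanSpace ℝ (Fin d) × EuclideanSpace ℝ (Fin d) =>
      PhiAux p z.1 z.2) := by
  unfold PhiAux
  refine Measurable.ite (measurableSet_eq_fun measurable_fst measurable_snd)
    measurable_const ?_
  fun_prop

theorem abs_intervalIntegral_sub_le {f g φ : ℝ → ℝ} (hf : Measurable f) (hg : Measurable g)
    (hφ : Measurable φ) (hφ0 : ∀ s, 0 ≤ φ s) {K : ℝ} (hK : 0 ≤ K)
    (hfg : ∀ s, |f s - g s| ≤ K * φ s)
    (hfin : ∫⁻ s in Set.Ioi (0 : ℝ), ENNReal.ofReal (φ s) ≠ ⊤) {t : ℝ} (ht : 0 ≤ t) :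
    |(∫ s in (0 : ℝ)..t, f s) - ∫ s in (0 : ℝ)..t, g s| ≤
      K * (∫⁻ s in Set.Ioi (0 : ℝ), ENNReal.ofReal (φ s)).toReal := by
  have hint : IntegrableOn φ (Set.Ioi 0) := by
    refine ⟨hφ.aestronglyMeasurable, ?_⟩
    rw [hasFiniteIntegral_iff_ofReal (Eventually.of_forall hφ0)]
    exact hfin.lt_top
  have hint' : IntegrableOn φ (Set.Ioc 0 t) := hint.mono_set Set.Ioc_subset_Ioi_self
  have heq : ∫ s in Set.Ioi (0 : ℝ), φ s =
      (∫⁻ s in Set.Ioi (0 : ℝ), ENNReal.ofReal (φ s)).toReal :=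
    integral_eq_lintegral_of_nonneg_ae (Eventually.of_forall hφ0) hφ.aestronglyMeasurable
  have hd : IntegrableOn (fun s => f s - g s) (Set.Ioc 0 t) :=
    Integrable.mono' (hint'.const_mul K) (hf.sub hg).aestronglyMeasurable
      (Eventually.of_forall hfg)
  rw [intervalIntegral.integral_of_le ht, intervalIntegral.integral_of_le ht, ← heq]
  by_cases hgi : IntegrableOn g (Set.Ioc 0 t)
  · have hfi : IntegrableOn f (Set.Ioc 0 t) := by
      simpa [IntegrableOn] using (Integrable.add hd hgi).congr
        (Eventually.of_forall fun s => by simp : _ =ᵐ[_] f)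
    rw [← integral_sub hfi hgi]
    calc |∫ s in Set.Ioc 0 t, (f s - g s)| ≤ ∫ s in Set.Ioc 0 t, K * φ s := by
          rw [← Real.norm_eq_abs]
          exact norm_integral_le_of_norm_le (hint'.const_mul K) (Eventually.of_forall hfg)
      _ = K * ∫ s in Set.Ioc 0 t, φ s := integral_const_mul _ _
      _ ≤ K * ∫ s in Set.Ioi 0, φ s :=
          mul_le_mul_of_nonneg_left
            (setIntegral_mono_set hint (Eventually.of_forall hφ0)
              Set.Ioc_subset_Ioi_self.eventuallyLE) hK
  · have hfi : ¬ IntegrableOn f (Set.Ioc 0 t) := fun hfi =>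
      hgi ((Integrable.sub hfi hd).congr
        (Eventually.of_forall fun s => by simp : _ =ᵐ[_] g))
    rw [integral_undef hfi, integral_undef hgi]
    simpa using mul_nonneg hK (integral_nonneg hφ0)

theorem ModerateScale.tendsto_mul_sub_atBot {a : ℝ → ℝ} (ha : ModerateScale a) (M : ℝ)
    {c : ℝ} (hc : 0 < c) :
    Tendsto (fun t => t / a t ^ 2 * (M - c * a t)) atTop atBot := by
  obtain ⟨hpos, h1, h2⟩ := ha
  have hdiv : Tendsto (fun t => t / a t) atTop atTop := by
    have : Tendsto (fun t => a t / t) atTop (𝓝[>] 0) :=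
      tendsto_nhdsWithin_iff.2 ⟨h2, by
        filter_upwards [eventually_gt_atTop 0] with t ht using div_pos (hpos t ht) ht⟩
    simpa [Pi.inv_def] using this.inv_tendsto_nhdsGT_zero
  have hM : Tendsto (fun t => (√t / a t) ^ 2 * M) atTop (𝓝 0) := by
    simpa using (h1.pow 2).mul_const M
  have hmain : Tendsto (fun t => (√t / a t) ^ 2 * M + -(c * (t / a t))) atTop atBot :=
    hM.add_atBot (tendsto_neg_atTop_atBot.comp (hdiv.const_mul_atTop hc))
  refine hmain.congr' ?_
  filter_upwards [eventually_gt_atTop 0] with t ht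
  have := (hpos t ht).ne'
  rw [div_pow, Real.sq_sqrt ht.le]
  field_simp
  ring

theorem measure_le_exp_sub_of_lintegral_exp_lt_top {Ω : Type*} [MeasurableSpace Ω]
    {P : Measure Ω} {I : Ω → EReal} (hI : Measurable I)
    (h : ∫⁻ ω, EReal.exp (I ω) ∂P < ⊤) :
    ∃ M : ℝ, ∀ r : ℝ, ENNReal.log (P {ω | (r : EReal) ≤ I ω}) ≤ ((M - r : ℝ) : EReal) := by
  set C := ∫⁻ ω, EReal.exp (I ω) ∂P with hC
  have hpos : 0 < C.toReal + 1 := by positivity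
  refine ⟨Real.log (C.toReal + 1), fun r => ?_⟩
  have hmk := mul_meas_ge_le_lintegral (μ := P) (EReal.measurable_exp.comp hI)
    (ENNReal.ofReal (Real.exp r))
  have hset : {ω | (r : EReal) ≤ I ω} =
      {ω | ENNReal.ofReal (Real.exp r) ≤ (EReal.exp ∘ I) ω} := by
    ext ω
    simp [← EReal.exp_coe]
  rw [← hset] at hmk
  have hCle : C ≤ ENNReal.ofReal (C.toReal + 1) := by
    conv_lhs => rw [← ENNReal.ofReal_toReal h.ne]
    exact ENNReal.ofReal_le_ofReal (by linarith)
  have hP : P {ω | (r : EReal) ≤ I ω} ≤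
      EReal.exp ((Real.log (C.toReal + 1) - r : ℝ) : EReal) := by
    rw [EReal.exp_coe, Real.exp_sub, Real.exp_log hpos,
      ENNReal.ofReal_div_of_pos (Real.exp_pos r)]
    refine (ENNReal.le_div_iff_mul_le (Or.inl (by simp [Real.exp_pos]))
      (Or.inl ENNReal.ofReal_ne_top)).2 ?_
    rw [mul_comm]
    exact hmk.trans hCle
  calc _ ≤ ENNReal.log (EReal.exp ((Real.log (C.toReal + 1) - r : ℝ) : EReal)) :=
        ENNReal.log_monotone hP
    _ = _ := EReal.log_exp _

theorem stmt_7
    {Ω : Type*} [MeasurableSpace Ω] (P : Measure Ω) [IsProbabilityMeasure P]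
    (d : ℕ)
    (X Xbar : ℝ → Ω → EuclideanSpace ℝ (Fin d))
    (hX : Measurable (Function.uncurry X)) (hXbar : Measurable (Function.uncurry Xbar))
    (p : ℝ) (hp : 1 < p) (K : ℝ) (hK : 0 ≤ K)
    (A : EuclideanSpace ℝ (Fin d) → ℝ) (hA_meas : Measurable A)
    (hA : ∀ x y : EuclideanSpace ℝ (Fin d), x ≠ y → |A x - A y| ≤ K * PhiAux p x y)
    (m : ℝ)
    (hexp : ∃ δ > (0 : ℝ),
      (∫⁻ ω, EReal.exp ((δ : EReal) *
          ((∫⁻ s in Set.Ioi (0 : ℝ), ENNReal.ofReal (PhiAux p (X s ω) (Xbar s ω))) :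
            EReal)) ∂P) < ⊤) :
    ∀ a : ℝ → ℝ, ModerateScale a → ∀ ε > (0 : ℝ),
      Tendsto
        (fun t => ((t / (a t) ^ 2 : ℝ) : EReal) *
          ENNReal.log (P {ω | ε <
            |((1 / a t) * ∫ s in (0 : ℝ)..t, (A (X s ω) - m)) -
              ((1 / a t) * ∫ s in (0 : ℝ)..t, (A (Xbar s ω) - m))|}))
        atTop (𝓝 ⊥) := by
  intro a ha ε hε
  obtain ⟨δ, hδ, hlt⟩ := hexp
  have hΦ0 : ∀ x y : EuclideanSpace ℝ (Fin d), 0 ≤ PhiAux p x y := by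
    intro x y
    have hlog : ∀ u : ℝ, 0 ≤ u → 0 ≤ Real.log (Real.exp 1 + u) := fun u hu =>
      Real.log_nonneg (by linarith [Real.one_le_exp zero_le_one])
    unfold PhiAux
    split_ifs
    · exact le_rfl
    · have h1 := hlog (‖x‖ ^ 2 + ‖y‖ ^ 2) (by positivity)
      rw [← add_assoc] at h1
      have h2 := hlog ‖x - y‖⁻¹ (by positivity)
      positivity
  have hA' : ∀ x y : EuclideanSpace ℝ (Fin d), |A x - A y| ≤ K * PhiAux p x y := by
    intro x y
    by_cases hxy : x = y
    · subst hxy; simp [PhiAux]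
    · exact hA x y hxy
  have hΦm : Measurable (fun z : ℝ × Ω => PhiAux p (X z.1 z.2) (Xbar z.1 z.2)) :=
    (measurable_PhiAux p).comp (hX.prodMk hXbar)
  set J : Ω → ENNReal := fun ω =>
    ∫⁻ s in Set.Ioi (0 : ℝ), ENNReal.ofReal (PhiAux p (X s ω) (Xbar s ω)) with hJ
  have hJm : Measurable J := by
    refine Measurable.lintegral_prod_left' (f := fun z : ℝ × Ω =>
      ENNReal.ofReal (PhiAux p (X z.1 z.2) (Xbar z.1 z.2))) ?_
    exact ENNReal.measurable_ofReal.comp hΦm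
  have hIm : Measurable (fun ω => (δ : EReal) * (J ω : EReal)) :=
    measurable_const.mul hJm.coe_ereal_ennreal
  have hJfin : ∀ᵐ ω ∂P, J ω ≠ ⊤ := by
    filter_upwards [ae_lt_top (EReal.measurable_exp.comp hIm) hlt.ne] with ω hω hJω
    rw [Function.comp_apply, hJω, EReal.coe_ennreal_top, EReal.coe_mul_top_of_pos hδ] at hω
    simp at hω
  obtain ⟨M, hM⟩ := measure_le_exp_sub_of_lintegral_exp_lt_top hIm hlt
  set c : ℝ := δ * ε / (K + 1) with hc
  have hcpos : 0 < c := by positivity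
  have hlim : Tendsto (fun t => ((t / a t ^ 2 * (M - c * a t) : ℝ) : EReal)) atTop (𝓝 ⊥) :=
    EReal.tendsto_coe_nhds_bot_iff.2 (ha.tendsto_mul_sub_atBot M hcpos)
  refine tendsto_nhds_bot_mono hlim ?_
  filter_upwards [eventually_gt_atTop 0] with t ht
  have hat := ha.1 t ht
  rw [EReal.coe_mul]
  refine mul_le_mul_of_nonneg_left ?_ (EReal.coe_nonneg.2 (by positivity))
  refine (ENNReal.log_monotone (measure_mono_ae ?_)).trans (hM (c * a t))
  filter_upwards [hJfin] with ω hω hdev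
  have hmeas : ∀ {Y : ℝ → Ω → EuclideanSpace ℝ (Fin d)}, Measurable (Function.uncurry Y) →
      Measurable (fun s => A (Y s ω) - m) := fun hY =>
    (hA_meas.comp (hY.comp measurable_prodMk_right)).sub_const m
  have hbound := abs_intervalIntegral_sub_le (hmeas hX) (hmeas hXbar)
    (hΦm.comp (measurable_prodMk_right (y := ω))) (fun s => hΦ0 _ _) hK
    (fun s => by simpa using hA' (X s ω) (Xbar s ω)) hω ht.le
  replace hbound : _ ≤ K * (J ω).toReal := hbound
  change ε < _ at hdev
  rw [← mul_sub, abs_mul, abs_of_pos (by positivity : 0 < 1 / a t), one_div_mul_eq_div,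
    lt_div_iff₀ hat] at hdev
  have hJ0 : 0 ≤ (J ω).toReal := ENNReal.toReal_nonneg
  have hreal : c * a t ≤ δ * (J ω).toReal := by
    rw [hc, div_mul_eq_mul_div, div_le_iff₀ (by positivity), mul_assoc, mul_assoc]
    exact mul_le_mul_of_nonneg_left (by linarith) hδ.le
  change ((c * a t : ℝ) : EReal) ≤ (δ : EReal) * (J ω : EReal)
  rw [← EReal.coe_toReal (x := (J ω : EReal)) (by simpa using hω) (by simp),
    ← EReal.coe_mul, EReal.coe_le_coe_iff, EReal.toReal_coe_ennreal]
  exact hreal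
end

section
/- For all real numbers λ > 0, p > 1 and β > 0, ∫₀^∞ [ log( e + β^{−1} e^{λ t} ) ]^{−p} dt ≤ log(1 + β)/λ + (1 + e)/(λ (p − 1)). -/
open MeasureTheory

open Filter Topology in
theorem lintegral_Ioi_one_add_mul_sub_rpow_neg {a p c : ℝ} (ha : 0 < a) (hp : 1 < p) :
    (∫⁻ t in Set.Ioi c, ENNReal.ofReal ((1 + a * (t - c)) ^ (-p))) =
      ENNReal.ofReal (1 / (a * (p - 1))) := by
  have hp' : 0 < p - 1 := by linarith
  have hbase : ∀ t ∈ Set.Ici c, 0 < 1 + a * (t - c) := fun t ht => by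
    have : 0 ≤ a * (t - c) := mul_nonneg ha.le (sub_nonneg.2 ht)
    linarith
  have hderiv : ∀ t ∈ Set.Ici c, HasDerivAt
      (fun t => -(1 / (a * (p - 1))) * (1 + a * (t - c)) ^ (-(p - 1)))
      ((1 + a * (t - c)) ^ (-p)) t := fun t ht => by
    have hlin : HasDerivAt (fun t => 1 + a * (t - c)) a t := by
      simpa using (((hasDerivAt_id t).sub_const c).const_mul a).const_add 1
    have h := (hlin.rpow_const (p := -(p - 1)) (Or.inl (hbase t ht).ne')).const_mul
      (-(1 / (a * (p - 1))))
    rw [show -(p - 1) - 1 = -p by ring] at h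
    exact h.congr_deriv (by field_simp)
  have hnonneg : ∀ t ∈ Set.Ioi c, 0 ≤ (1 + a * (t - c)) ^ (-p) := fun t ht =>
    (Real.rpow_pos_of_pos (hbase t (Set.Ioi_subset_Ici_self ht)) _).le
  have hlim : Tendsto (fun t => -(1 / (a * (p - 1))) * (1 + a * (t - c)) ^ (-(p - 1)))
      atTop (𝓝 0) := by
    have hlin : Tendsto (fun t => 1 + a * (t - c)) atTop atTop :=
      tendsto_atTop_add_const_left _ _
        ((tendsto_atTop_add_const_right _ (-c) tendsto_id).const_mul_atTop ha)
    simpa using ((tendsto_rpow_neg_atTop hp').comp hlin).const_mul (-(1 / (a * (p - 1))))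
  rw [← ofReal_integral_eq_lintegral_ofReal
      (integrableOn_Ioi_deriv_of_nonneg' hderiv hnonneg hlim)
      ((ae_restrict_iff' measurableSet_Ioi).2 (ae_of_all _ hnonneg)),
    integral_Ioi_of_hasDerivAt_of_nonneg' hderiv hnonneg hlim]
  simp

theorem one_add_div_le_log_exp_one_add_exp {u : ℝ} :
    1 + u / (1 + Real.exp 1) ≤ Real.log (Real.exp 1 + Real.exp u) := by
  have he := Real.exp_pos 1
  have hw := Real.exp_pos (u / (1 + Real.exp 1))
  rw [Real.le_log_iff_exp_le (by positivity), Real.exp_add]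
  have h := one_add_mul_self_le_rpow_one_add
    (s := Real.exp (u / (1 + Real.exp 1)) - 1) (by linarith) (p := 1 + Real.exp 1) (by linarith)
  rw [add_sub_cancel, ← Real.exp_mul, div_mul_cancel₀ _ (by positivity)] at h
  linarith

theorem stmt_8 (lam p β : ℝ) (hlam : 0 < lam) (hp : 1 < p) (hβ : 0 < β) :
    (∫⁻ t in Set.Ioi (0 : ℝ),
        ENNReal.ofReal (Real.log (Real.exp 1 + β⁻¹ * Real.exp (lam * t)) ^ (-p))) ≤
      ENNReal.ofReal (Real.log (1 + β) / lam + (1 + Real.exp 1) / (lam * (p - 1))) := by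
  have hp' : 0 < p - 1 := by linarith
  have he := Real.exp_pos 1
  set c := Real.log (1 + β) / lam with hc
  have hc0 : 0 ≤ c := div_nonneg (Real.log_nonneg (by linarith)) hlam.le
  rw [← Set.Ioc_union_Ioi_eq_Ioi hc0,
    lintegral_union measurableSet_Ioi (Set.Ioc_disjoint_Ioi le_rfl),
    ENNReal.ofReal_add hc0 (by positivity)]
  refine add_le_add ?_ ?_
  · calc _ ≤ ∫⁻ _ in Set.Ioc 0 c, (1 : ENNReal) := by
          refine lintegral_mono fun t => ?_
          rw [← ENNReal.ofReal_one]
          refine ENNReal.ofReal_le_ofReal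
            (Real.rpow_le_one_of_one_le_of_nonpos ?_ (by linarith))
          rw [Real.le_log_iff_exp_le (by positivity)]
          exact le_add_of_nonneg_right (by positivity)
      _ = ENNReal.ofReal c := by simp
  · have ha : 0 < lam / (1 + Real.exp 1) := by positivity
    calc _ ≤ ∫⁻ t in Set.Ioi c,
            ENNReal.ofReal ((1 + lam / (1 + Real.exp 1) * (t - c)) ^ (-p)) := by
          refine setLIntegral_mono' measurableSet_Ioi fun t ht => ?_
          have hpos : 0 < lam / (1 + Real.exp 1) * (t - c) := mul_pos ha (sub_pos.2 ht)
          refine ENNReal.ofReal_le_ofReal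
            (Real.rpow_le_rpow_of_nonpos (by linarith) ?_ (by linarith))
          have hshift : Real.exp (lam * (t - c)) ≤ β⁻¹ * Real.exp (lam * t) := by
            rw [mul_sub, hc, mul_div_cancel₀ _ hlam.ne', Real.exp_sub,
              Real.exp_log (by linarith), div_eq_inv_mul]
            gcongr
            linarith
          calc _ = 1 + lam * (t - c) / (1 + Real.exp 1) := by ring
            _ ≤ _ := one_add_div_le_log_exp_one_add_exp
            _ ≤ _ := by gcongr
      _ = _ := by
          rw [lintegral_Ioi_one_add_mul_sub_rpow_neg ha hp]
          congr 1
          field_simp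
end

section
/- For all real numbers α ≥ 0 and β ≥ 0, ((e + α) / log(e + α)) · log(e + β) ≤ e + α + β. -/
theorem stmt_9 (α β : ℝ) (hα : 0 ≤ α) (hβ : 0 ≤ β) :
    (Real.exp 1 + α) / Real.log (Real.exp 1 + α) * Real.log (Real.exp 1 + β) ≤
      Real.exp 1 + α + β := by
  have hx : 0 < Real.exp 1 + α := by positivity
  have hy : 0 < Real.exp 1 + β := by positivity
  have hL : 1 ≤ Real.log (Real.exp 1 + α) :=
    (Real.le_log_iff_exp_le hx).2 (by linarith)
  have hxL : Real.exp (Real.log (Real.exp 1 + α)) = Real.exp 1 + α := Real.exp_log hx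
  set x := Real.exp 1 + α
  set y := Real.exp 1 + β with hy_def
  set L := Real.log x with hL_def
  have hL0 : 0 < L := by linarith
  have tangent : Real.log y + Real.log L - L ≤ y * L / x - 1 := by
    have h := Real.log_le_sub_one_of_pos (show 0 < y * L / x by positivity)
    rwa [Real.log_div (by positivity) hx.ne', Real.log_mul hy.ne' hL0.ne'] at h
  have scaled : x * (Real.log y + Real.log L - L) ≤ y * L - x := by
    have h := mul_le_mul_of_nonneg_left tangent hx.le
    have h_eq : x * (y * L / x - 1) = y * L - x := by field_simp
    rwa [h_eq] at h
  have exp_bound : Real.exp 1 * L ≤ x := by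
    have h := Real.add_one_le_exp (L - 1)
    calc Real.exp 1 * L ≤ Real.exp 1 * Real.exp (L - 1) := by gcongr; linarith
      _ = x := by rw [← Real.exp_add, ← hxL]; ring_nf
  have log_nonneg : 0 ≤ x * Real.log L := mul_nonneg hx.le (Real.log_nonneg hL)
  rw [div_mul_eq_mul_div, div_le_iff₀ hL0]
  have h_beta : β = y - Real.exp 1 := by rw [hy_def]; ring
  rw [h_beta]
  linarith
end

section
/- Fix β ≥ 0 and define h : [β, ∞) → ℝ by h(α) = ((e + α)/log(e + α)) · log(e + β) − α. Then h is nonincreasing on [β, ∞); that is, for all β ≤ α₁ ≤ α₂, h(α₂) ≤ h(α₁). In particular, for every α ≥ β, ((e + α)/log(e + α)) · log(e + β) ≤ α + e. -/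
theorem stmt_11 (β : ℝ) (hβ : 0 ≤ β) :
    (∀ α₁ α₂ : ℝ, β ≤ α₁ → α₁ ≤ α₂ →
      (Real.exp 1 + α₂) / Real.log (Real.exp 1 + α₂) * Real.log (Real.exp 1 + β) - α₂ ≤
        (Real.exp 1 + α₁) / Real.log (Real.exp 1 + α₁) * Real.log (Real.exp 1 + β) - α₁) ∧
    (∀ α : ℝ, β ≤ α →
      (Real.exp 1 + α) / Real.log (Real.exp 1 + α) * Real.log (Real.exp 1 + β) ≤
        α + Real.exp 1) := by
  have he := Real.exp_pos 1
  have hL : 0 < Real.log (Real.exp 1 + β) := by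
    have h := Real.log_le_log he (show Real.exp 1 ≤ Real.exp 1 + β by linarith)
    rw [Real.log_exp] at h
    linarith
  have hmono : ∀ α, β ≤ α →
      Real.log (Real.exp 1 + β) ≤ Real.log (Real.exp 1 + α) := fun α hα =>
    Real.log_le_log (by linarith) (by linarith)
  have hratio : ∀ α, β ≤ α →
      Real.log (Real.exp 1 + β) / Real.log (Real.exp 1 + α) ≤ 1 := fun α hα =>
    div_le_one_of_le₀ (hmono α hα) (hL.le.trans (hmono α hα))
  refine ⟨fun α₁ α₂ h₁ h₂ => ?_, fun α hα => ?_⟩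
  · have hanti : Real.log (Real.exp 1 + β) / Real.log (Real.exp 1 + α₂) ≤
        Real.log (Real.exp 1 + β) / Real.log (Real.exp 1 + α₁) :=
      div_le_div_of_nonneg_left hL.le (hL.trans_le (hmono α₁ h₁))
        (Real.log_le_log (by linarith) (by linarith))
    have hprod := mul_le_mul (show Real.exp 1 + α₁ ≤ Real.exp 1 + α₂ by linarith)
      (sub_le_sub_left hanti 1) (sub_nonneg.2 (hratio α₁ h₁)) (by linarith)
    rw [div_mul_eq_mul_div, div_mul_eq_mul_div, mul_div_assoc, mul_div_assoc]
    linarith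
  · have h := mul_le_mul_of_nonneg_left (hratio α hα) (show 0 ≤ Real.exp 1 + α by linarith)
    rw [div_mul_eq_mul_div, mul_div_assoc]
    linarith
end
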